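/- Let G be a φ-expander on n vertices with minimum degree d_min and total degree D = Σᵤ dᵤ, and let M = I − (1/2)L̃. Then for any vertices u, v and any integer k ≥ 0, (M^k)_{u,v} ≤ √(dᵤdᵥ) · (1/D + (1/d_min − 1/D)·e^{−φ²k/4}). -/

import Mathlib

open Finset Matrix

/-- Volume of a vertex set: the sum of degrees. -/
def gvol {n : ℕ} (G : SimpleGraph (Fin n)) [DecidableRel G.Adj] (S : Finset (Fin n)) : ℕ :=
  ∑ v ∈ S, G.degree v

/-- Number of edges of `G` crossing from `S` to its complement. -/
def gcut {n : ℕ} (G : SimpleGraph (Fin n)) [DecidableRel G.Adj] (S : Finset (Fin n)) : ℕ :=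
  ∑ u ∈ S, (Sᶜ.filter (G.Adj u)).card

/-- `G` has conductance at least `φ`. -/
def IsExpander {n : ℕ} (G : SimpleGraph (Fin n)) [DecidableRel G.Adj] (φ : ℝ) : Prop :=
  ∀ S : Finset (Fin n), S.Nonempty → (gvol G S : ℝ) ≤ (gvol G univ : ℝ) / 2 →
    φ * (gvol G S : ℝ) ≤ (gcut G S : ℝ)

section SymmetricContraction

variable {ι : Type*} [Fintype ι] {M : Matrix ι ι ℝ} {s : ι → ℝ} {r : ℝ}

lemma Matrix.IsSymm.dotProduct_mulVec_comm {N : Matrix ι ι ℝ} (hN : N.IsSymm) (x y : ι → ℝ) :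
    x ⬝ᵥ (N *ᵥ y) = (N *ᵥ x) ⬝ᵥ y := by
  rw [dotProduct_mulVec, ← mulVec_transpose, hN.eq]

/-- A positive semidefinite quadratic form bounded by `r` on the complement of a fixed vector
contracts that complement by the factor `r`. -/
lemma mulVec_dotProduct_self_le (hM : M.IsSymm) (hs : M *ᵥ s = s) (hr : 0 < r)
    (hpos : ∀ x, 0 ≤ x ⬝ᵥ (M *ᵥ x)) (hle : ∀ x, x ⬝ᵥ s = 0 → x ⬝ᵥ (M *ᵥ x) ≤ r * (x ⬝ᵥ x))
    {x : ι → ℝ} (hx : x ⬝ᵥ s = 0) :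
    (M *ᵥ x) ⬝ᵥ (M *ᵥ x) ≤ r ^ 2 * (x ⬝ᵥ x) := by
  have hMx : (M *ᵥ x) ⬝ᵥ s = 0 := by rw [← hM.dotProduct_mulVec_comm, hs, hx]
  have h1 := hpos (r • x - M *ᵥ x)
  have h2 := hle x hx
  have h3 := hle _ hMx
  have h4 := hM.dotProduct_mulVec_comm x (M *ᵥ x)
  simp only [mulVec_sub, mulVec_smul, sub_dotProduct, dotProduct_sub, smul_dotProduct,
    dotProduct_smul, smul_eq_mul, h4] at h1
  have h5 := mul_le_mul_of_nonneg_left h2 (sq_nonneg r)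
  have h6 : r * ((M *ᵥ x) ⬝ᵥ (M *ᵥ x)) ≤ r * (r ^ 2 * (x ⬝ᵥ x)) := by linarith
  exact le_of_mul_le_mul_left h6 hr

lemma dotProduct_le_sqrt_mul_sqrt (x y : ι → ℝ) : x ⬝ᵥ y ≤ √(x ⬝ᵥ x) * √(y ⬝ᵥ y) := by
  simpa [dotProduct, sq] using Real.sum_mul_le_sqrt_mul_sqrt univ x y

variable [DecidableEq ι]

lemma pow_mulVec_dotProduct_self_le (hM : M.IsSymm) (hs : M *ᵥ s = s) (hr : 0 < r)
    (hpos : ∀ x, 0 ≤ x ⬝ᵥ (M *ᵥ x)) (hle : ∀ x, x ⬝ᵥ s = 0 → x ⬝ᵥ (M *ᵥ x) ≤ r * (x ⬝ᵥ x))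
    {x : ι → ℝ} (hx : x ⬝ᵥ s = 0) (k : ℕ) :
    (M ^ k *ᵥ x) ⬝ᵥ s = 0 ∧
      (M ^ k *ᵥ x) ⬝ᵥ (M ^ k *ᵥ x) ≤ (r ^ k) ^ 2 * (x ⬝ᵥ x) := by
  induction k with
  | zero => simp [hx]
  | succ k ih =>
    rw [pow_succ', ← mulVec_mulVec]
    refine ⟨by rw [← hM.dotProduct_mulVec_comm, hs, ih.1], ?_⟩
    calc _ ≤ r ^ 2 * ((M ^ k *ᵥ x) ⬝ᵥ (M ^ k *ᵥ x)) :=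
          mulVec_dotProduct_self_le hM hs hr hpos hle ih.1
      _ ≤ r ^ 2 * ((r ^ k) ^ 2 * (x ⬝ᵥ x)) := by gcongr; exact ih.2
      _ = _ := by ring

lemma pow_mulVec_eq_self (hs : M *ᵥ s = s) (k : ℕ) : M ^ k *ᵥ s = s := by
  induction k with
  | zero => simp
  | succ k ih => rw [pow_succ, ← mulVec_mulVec, hs, ih]

/-- Entries of powers of a matrix with a fixed vector `s` that contracts the complement of `s`. -/
lemma pow_apply_le (hM : M.IsSymm) (hs : M *ᵥ s = s) (hr : 0 < r)
    (hpos : ∀ x, 0 ≤ x ⬝ᵥ (M *ᵥ x)) (hle : ∀ x, x ⬝ᵥ s = 0 → x ⬝ᵥ (M *ᵥ x) ≤ r * (x ⬝ᵥ x))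
    (hs0 : s ⬝ᵥ s ≠ 0) (u v : ι) (k : ℕ) :
    (M ^ k) u v ≤ s u * s v / (s ⬝ᵥ s) +
      r ^ k * (√(1 - s u ^ 2 / (s ⬝ᵥ s)) * √(1 - s v ^ 2 / (s ⬝ᵥ s))) := by
  set p : ι → ι → ℝ := fun w ↦ Pi.single w 1 - (s w / (s ⬝ᵥ s)) • s with hp
  have hps : ∀ w, p w ⬝ᵥ s = 0 := fun w ↦ by simp [hp, sub_dotProduct, hs0]
  have hpp : ∀ w, p w ⬝ᵥ p w = 1 - s w ^ 2 / (s ⬝ᵥ s) := fun w ↦ by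
    have h : p w ⬝ᵥ p w = p w ⬝ᵥ Pi.single w 1 := by
      nth_rw 2 [show p w = Pi.single w 1 - (s w / (s ⬝ᵥ s)) • s from rfl]
      rw [dotProduct_sub, dotProduct_smul, hps, smul_zero, sub_zero]
    rw [h]
    simp [hp]
    ring
  have key : (M ^ k) u v = s u * s v / (s ⬝ᵥ s) + p u ⬝ᵥ (M ^ k *ᵥ p v) := by
    have h1 : p u ⬝ᵥ (M ^ k *ᵥ p v) = Pi.single u 1 ⬝ᵥ (M ^ k *ᵥ p v) := by
      have := (pow_mulVec_dotProduct_self_le hM hs hr hpos hle (hps v) k).1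
      rw [dotProduct_comm] at this
      nth_rw 1 [show p u = Pi.single u 1 - (s u / (s ⬝ᵥ s)) • s from rfl]
      rw [sub_dotProduct, smul_dotProduct, this, smul_zero, sub_zero]
    rw [h1]
    simp only [hp, mulVec_sub, mulVec_smul, pow_mulVec_eq_self hs]
    simp
    ring
  rw [key]
  gcongr
  calc _ ≤ √(p u ⬝ᵥ p u) * √((M ^ k *ᵥ p v) ⬝ᵥ (M ^ k *ᵥ p v)) := dotProduct_le_sqrt_mul_sqrt _ _
    _ ≤ √(p u ⬝ᵥ p u) * √((r ^ k) ^ 2 * (p v ⬝ᵥ p v)) := by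
        gcongr; exact (pow_mulVec_dotProduct_self_le hM hs hr hpos hle (hps v) k).2
    _ = _ := by
        rw [Real.sqrt_mul (sq_nonneg _), Real.sqrt_sq (by positivity), hpp, hpp]; ring

end SymmetricContraction

section WeightedMedian

/-- A weighted median: at most half of the weight lies strictly on either side. -/
lemma exists_weighted_median {ι : Type*} [Fintype ι] [Nonempty ι] (w y : ι → ℝ)
    (hw : ∀ i, 0 ≤ w i) :
    ∃ c, ∑ i with c < y i, w i ≤ (∑ i, w i) / 2 ∧ ∑ i with y i < c, w i ≤ (∑ i, w i) / 2 := by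
  classical
  set T : Finset ι := univ.filter fun k ↦ ∑ i with y k < y i, w i ≤ (∑ i, w i) / 2 with hT
  have hTne : T.Nonempty := by
    obtain ⟨m, -, hm⟩ := exists_max_image univ y univ_nonempty
    refine ⟨m, by
      rw [hT, mem_filter, filter_false_of_mem fun i hi ↦ not_lt.2 (hm i hi)]
      simpa using div_nonneg (sum_nonneg fun i _ ↦ hw i) zero_le_two⟩
  obtain ⟨k, hk, hmin⟩ := exists_min_image T y hTne
  refine ⟨y k, (mem_filter.1 hk).2, ?_⟩
  by_contra! hlt
  have hne : (univ.filter fun i ↦ y i < y k).Nonempty := by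
    rw [nonempty_iff_ne_empty]
    intro h
    rw [h, sum_empty] at hlt
    linarith [sum_nonneg fun i (_ : i ∈ (univ : Finset ι)) ↦ hw i]
  obtain ⟨l, hl, hmax⟩ := exists_max_image _ y hne
  have hlk := (mem_filter.1 hl).2
  have hlT : l ∈ T := by
    rw [hT, mem_filter]
    refine ⟨mem_univ _, ?_⟩
    have hsplit := sum_filter_add_sum_filter_not univ (fun i ↦ y i < y k) w
    have heq : univ.filter (fun i ↦ y l < y i) = univ.filter fun i ↦ ¬ y i < y k := by
      ext i
      simp only [mem_filter, mem_univ, true_and, not_lt]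
      refine ⟨fun h ↦ ?_, fun h ↦ hlk.trans_le h⟩
      by_contra! h'
      exact absurd (hmax i (by simpa using h')) (not_le.2 h)
    rw [heq]
    linarith
  exact absurd (hmin l hlT) (not_le.2 hlk)

end WeightedMedian

section Cheeger

variable {n : ℕ} (G : SimpleGraph (Fin n)) [DecidableRel G.Adj] {φ : ℝ}

lemma sum_adjMatrix_eq_degree (i : Fin n) : ∑ j, G.adjMatrix ℝ i j = G.degree i := by
  simp [SimpleGraph.adjMatrix_apply, ← SimpleGraph.card_neighborFinset_eq_degree,
    SimpleGraph.neighborFinset_eq_filter]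

lemma adjMatrix_nonneg (i j : Fin n) : 0 ≤ G.adjMatrix ℝ i j := by
  rw [SimpleGraph.adjMatrix_apply]; split_ifs <;> simp

lemma sum_adjMatrix_mul_left (f : Fin n → ℝ) :
    ∑ i, ∑ j, G.adjMatrix ℝ i j * f i = ∑ i, G.degree i * f i := by
  simp_rw [← sum_mul, sum_adjMatrix_eq_degree]

lemma sum_adjMatrix_mul_right (f : Fin n → ℝ) :
    ∑ i, ∑ j, G.adjMatrix ℝ i j * f j = ∑ i, G.degree i * f i := by
  rw [sum_comm, ← sum_adjMatrix_mul_left]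
  simp_rw [(G.isSymm_adjMatrix (α := ℝ)).apply]

lemma sum_adjMatrix_abs_indicator (S : Finset (Fin n)) :
    ∑ i, ∑ j, G.adjMatrix ℝ i j *
      |(if i ∈ S then (1 : ℝ) else 0) - (if j ∈ S then 1 else 0)| = 2 * gcut G S := by
  have hc : (gcut G S : ℝ) =
      ∑ i, ∑ j, G.adjMatrix ℝ i j * (if i ∈ S ∧ j ∉ S then 1 else 0) := by
    simp only [gcut, card_filter, Nat.cast_sum, Nat.cast_ite, Nat.cast_one, Nat.cast_zero]
    rw [← sum_filter_add_sum_filter_not univ (· ∈ S) (fun i ↦ ∑ j, _)]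
    rw [sum_eq_zero (s := univ.filter (· ∉ S)), add_zero]
    · simp only [filter_mem_eq_inter, univ_inter]
      refine sum_congr rfl fun i hi ↦ ?_
      rw [← sum_filter_add_sum_filter_not univ (· ∉ S) (fun j ↦ _ * _)]
      rw [sum_eq_zero (s := univ.filter (¬ · ∉ S)), add_zero]
      · have : univ.filter (· ∉ S) = Sᶜ := by ext; simp
        rw [this]
        refine sum_congr rfl fun j hj ↦ ?_
        simp [hi, mem_compl.1 hj, SimpleGraph.adjMatrix_apply]
      · intro j hj; simp at hj; simp [hj]
    · intro i hi; simp at hi; simp [hi]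
  have hc' : (gcut G S : ℝ) =
      ∑ i, ∑ j, G.adjMatrix ℝ i j * (if j ∈ S ∧ i ∉ S then 1 else 0) := by
    rw [hc, sum_comm]
    simp_rw [(G.isSymm_adjMatrix (α := ℝ)).apply]
  rw [two_mul]
  nth_rw 1 [hc]
  rw [hc', ← sum_add_distrib]
  refine sum_congr rfl fun i _ ↦ ?_
  rw [← sum_add_distrib]
  refine sum_congr rfl fun j _ ↦ ?_
  rw [← mul_add]
  by_cases hi : i ∈ S <;> by_cases hj : j ∈ S <;> simp [hi, hj]

variable {G}

/-- The co-area inequality for nonnegative functions supported on at most half of the volume. -/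
lemma IsExpander.two_mul_sum_degree_mul_le (h : IsExpander G φ) {f : Fin n → ℝ}
    (hf : ∀ i, 0 ≤ f i) (hsupp : ∑ i with 0 < f i, (G.degree i : ℝ) ≤ (gvol G univ : ℝ) / 2) :
    2 * φ * ∑ i, G.degree i * f i ≤ ∑ i, ∑ j, G.adjMatrix ℝ i j * |f i - f j| := by
  induction hN : (univ.filter fun i ↦ 0 < f i).card using Nat.strong_induction_on
    generalizing f with
  | _ N ih =>
  set S := univ.filter fun i ↦ 0 < f i with hS
  have hS0 : ∀ i, i ∉ S → f i = 0 := fun i hi ↦ by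
    simp [hS] at hi; exact le_antisymm hi (hf i)
  rcases S.eq_empty_or_nonempty with hSe | hSne
  · have h0 : ∀ i, f i = 0 := fun i ↦ hS0 i (by simp [hSe])
    simp [h0]
  obtain ⟨m, hmS, hm⟩ := exists_min_image S f hSne
  have ht : 0 < f m := (mem_filter.1 hmS).2
  set χ : Fin n → ℝ := fun i ↦ if i ∈ S then 1 else 0 with hχ
  set g : Fin n → ℝ := fun i ↦ f i - f m * χ i with hg
  have hg0 : ∀ i, 0 ≤ g i := fun i ↦ by
    by_cases hi : i ∈ S
    · simpa [hg, hχ, hi] using hm i hi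
    · simp [hg, hχ, hi, hS0 i hi]
  have hsub : (univ.filter fun i ↦ 0 < g i) ⊂ S := by
    rw [ssubset_iff_of_subset]
    · exact ⟨m, hmS, by simp [hg, hχ, hmS]⟩
    · intro i hi
      by_contra hiS
      simp [hg, hχ, hiS, hS0 i hiS] at hi
  have hrec := ih _ (hN ▸ card_lt_card hsub) hg0
    ((sum_le_sum_of_subset_of_nonneg hsub.subset fun _ _ _ ↦ by positivity).trans hsupp) rfl
  have hcut := h S hSne (by simpa [gvol] using hsupp)
  have hvol : (gvol G S : ℝ) = ∑ i, G.degree i * χ i := by simp [gvol, hχ]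
  have hsplit : ∀ i j, |f i - f j| = f m * |χ i - χ j| + |g i - g j| := fun i j ↦ by
    by_cases hi : i ∈ S <;> by_cases hj : j ∈ S
    · simp [hg, hχ, hi, hj]
    · have := hm i hi
      simp [hg, hχ, hi, hj, hS0 j hj]
      rw [abs_of_nonneg (hf i), abs_of_nonneg (by linarith)]; ring
    · have := hm j hj
      simp [hg, hχ, hi, hj, hS0 i hi]
      rw [abs_of_nonneg (hf j), abs_of_nonpos (by linarith)]; ring
    · simp [hg, hχ, hi, hj]
  have hL : ∑ i, G.degree i * f i =
      f m * gvol G S + ∑ i, G.degree i * g i := by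
    rw [hvol, mul_sum, ← sum_add_distrib]
    exact sum_congr rfl fun i _ ↦ by simp only [hg]; ring
  have hR : ∑ i, ∑ j, G.adjMatrix ℝ i j * |f i - f j| =
      f m * (2 * gcut G S) + ∑ i, ∑ j, G.adjMatrix ℝ i j * |g i - g j| := by
    rw [← sum_adjMatrix_abs_indicator, mul_sum, ← sum_add_distrib]
    refine sum_congr rfl fun i _ ↦ ?_
    rw [mul_sum, ← sum_add_distrib]
    exact sum_congr rfl fun j _ ↦ by rw [hsplit]; ring
  rw [hL, hR]
  have := mul_le_mul_of_nonneg_left hcut ht.le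
  linarith

lemma IsExpander.sq_mul_sum_le_of_support (h : IsExpander G φ) (hφ : 0 ≤ φ) {p : Fin n → ℝ}
    (hp : ∀ i, 0 ≤ p i) (hsupp : ∑ i with 0 < p i, (G.degree i : ℝ) ≤ (gvol G univ : ℝ) / 2) :
    φ ^ 2 * ∑ i, G.degree i * p i ^ 2 ≤ ∑ i, ∑ j, G.adjMatrix ℝ i j * (p i - p j) ^ 2 := by
  have hpos : ∀ i, 0 < p i ^ 2 ↔ 0 < p i := fun i ↦ by
    rw [sq_pos_iff, (hp i).lt_iff_ne']
  have hco := h.two_mul_sum_degree_mul_le (f := fun i ↦ p i ^ 2) (fun i ↦ sq_nonneg _)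
    (by simpa only [hpos] using hsupp)
  have hpt : ∀ i j, φ * |p i ^ 2 - p j ^ 2| ≤
      (p i - p j) ^ 2 + φ ^ 2 / 2 * (p i ^ 2 + p j ^ 2) := fun i j ↦ by
    rw [sq_sub_sq, abs_mul, abs_of_nonneg (add_nonneg (hp i) (hp j)), ← sq_abs (p i - p j)]
    nlinarith [sq_nonneg (|p i - p j| - φ / 2 * (p i + p j)),
      mul_nonneg (sq_nonneg φ) (sq_nonneg (p i - p j))]
  have hsum : φ * ∑ i, ∑ j, G.adjMatrix ℝ i j * |p i ^ 2 - p j ^ 2| ≤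
      ∑ i, ∑ j, G.adjMatrix ℝ i j * (p i - p j) ^ 2 +
        φ ^ 2 * ∑ i, G.degree i * p i ^ 2 := by
    calc _ = ∑ i, ∑ j, G.adjMatrix ℝ i j * (φ * |p i ^ 2 - p j ^ 2|) := by
          simp only [mul_sum]
          exact sum_congr rfl fun i _ ↦ sum_congr rfl fun j _ ↦ by ring
      _ ≤ ∑ i, ∑ j, G.adjMatrix ℝ i j *
          ((p i - p j) ^ 2 + φ ^ 2 / 2 * (p i ^ 2 + p j ^ 2)) :=
          sum_le_sum fun i _ ↦ sum_le_sum fun j _ ↦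
            mul_le_mul_of_nonneg_left (hpt i j) (adjMatrix_nonneg G i j)
      _ = ∑ i, ∑ j, G.adjMatrix ℝ i j * (p i - p j) ^ 2 +
          φ ^ 2 / 2 * (∑ i, ∑ j, G.adjMatrix ℝ i j * p i ^ 2 +
            ∑ i, ∑ j, G.adjMatrix ℝ i j * p j ^ 2) := by
          simp only [mul_sum, ← sum_add_distrib]
          exact sum_congr rfl fun i _ ↦ sum_congr rfl fun j _ ↦ by ring
      _ = _ := by
          rw [sum_adjMatrix_mul_left G fun i ↦ p i ^ 2, sum_adjMatrix_mul_right G fun i ↦ p i ^ 2]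
          ring
  have := mul_le_mul_of_nonneg_left hco hφ
  nlinarith

lemma sq_posPart_sub_add_sq_negPart_sub_le (a b : ℝ) :
    (a⁺ - b⁺) ^ 2 + (a⁻ - b⁻) ^ 2 ≤ (a - b) ^ 2 := by
  rcases le_total 0 a with ha | ha <;> rcases le_total 0 b with hb | hb <;>
    simp only [posPart_of_nonneg, posPart_of_nonpos, negPart_of_nonneg, negPart_of_nonpos, ha, hb]
      <;> nlinarith

/-- The hard direction of Cheeger's inequality, for functions with degree-weighted mean zero. -/
lemma IsExpander.sq_mul_sum_le (h : IsExpander G φ) (hφ : 0 ≤ φ) {y : Fin n → ℝ}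
    (hy : ∑ i, G.degree i * y i = 0) :
    φ ^ 2 * ∑ i, G.degree i * y i ^ 2 ≤ ∑ i, ∑ j, G.adjMatrix ℝ i j * (y i - y j) ^ 2 := by
  rcases isEmpty_or_nonempty (Fin n) with _ | _
  · simp
  have hD : ∑ i, (G.degree i : ℝ) = gvol G univ := by simp [gvol]
  obtain ⟨c, hc₁, hc₂⟩ := exists_weighted_median (fun i ↦ (G.degree i : ℝ)) y
    fun i ↦ by positivity
  rw [hD] at hc₁ hc₂
  have h₁ := h.sq_mul_sum_le_of_support hφ (p := fun i ↦ (y i - c)⁺) (fun i ↦ posPart_nonneg _)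
    (by simpa only [posPart_pos_iff, sub_pos] using hc₁)
  have h₂ := h.sq_mul_sum_le_of_support hφ (p := fun i ↦ (y i - c)⁻) (fun i ↦ negPart_nonneg _)
    (by simpa only [negPart_pos_iff, sub_neg] using hc₂)
  have hE : ∑ i, ∑ j, G.adjMatrix ℝ i j * ((y i - c)⁺ - (y j - c)⁺) ^ 2 +
      ∑ i, ∑ j, G.adjMatrix ℝ i j * ((y i - c)⁻ - (y j - c)⁻) ^ 2 ≤
      ∑ i, ∑ j, G.adjMatrix ℝ i j * (y i - y j) ^ 2 := by
    simp only [← sum_add_distrib, ← mul_add]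
    refine sum_le_sum fun i _ ↦ sum_le_sum fun j _ ↦
      mul_le_mul_of_nonneg_left ?_ (adjMatrix_nonneg G i j)
    simpa using sq_posPart_sub_add_sq_negPart_sub_le (y i - c) (y j - c)
  have hQ : ∑ i, G.degree i * (y i - c)⁺ ^ 2 + ∑ i, G.degree i * (y i - c)⁻ ^ 2 =
      ∑ i, G.degree i * y i ^ 2 + c ^ 2 * gvol G univ := by
    have : ∀ a : ℝ, a⁺ ^ 2 + a⁻ ^ 2 = a ^ 2 := fun a ↦ by
      rcases le_total 0 a with ha | ha <;>
        simp [posPart_of_nonneg, posPart_of_nonpos, negPart_of_nonneg, negPart_of_nonpos, ha]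
    calc _ = ∑ i, G.degree i * y i ^ 2 + c ^ 2 * ∑ i, (G.degree i : ℝ) -
          2 * c * ∑ i, G.degree i * y i := by
          simp only [mul_sum, ← sum_add_distrib, ← sum_sub_distrib, ← mul_add, this]
          exact sum_congr rfl fun i _ ↦ by ring
      _ = _ := by rw [hy, hD]; ring
  have h₃ : 0 ≤ φ ^ 2 * (c ^ 2 * gvol G univ) := by positivity
  nlinarith

lemma sum_adjMatrix_mul_sub_sq (y : Fin n → ℝ) :
    ∑ i, ∑ j, G.adjMatrix ℝ i j * (y i - y j) ^ 2 =
      2 * ∑ i, G.degree i * y i ^ 2 - 2 * ∑ i, ∑ j, G.adjMatrix ℝ i j * (y i * y j) := by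
  rw [two_mul (∑ i, _)]
  nth_rw 1 [← sum_adjMatrix_mul_left G fun i ↦ y i ^ 2]
  rw [← sum_adjMatrix_mul_right G fun i ↦ y i ^ 2]
  simp only [mul_sum, ← sum_add_distrib, ← sum_sub_distrib]
  exact sum_congr rfl fun i _ ↦ sum_congr rfl fun j _ ↦ by ring

lemma neg_sum_degree_le (y : Fin n → ℝ) :
    -∑ i, G.degree i * y i ^ 2 ≤ ∑ i, ∑ j, G.adjMatrix ℝ i j * (y i * y j) := by
  have h : 0 ≤ ∑ i, ∑ j, G.adjMatrix ℝ i j * (y i + y j) ^ 2 :=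
    sum_nonneg fun i _ ↦ sum_nonneg fun j _ ↦ mul_nonneg (adjMatrix_nonneg G i j) (sq_nonneg _)
  have h' : ∑ i, ∑ j, G.adjMatrix ℝ i j * (y i + y j) ^ 2 =
      ∑ i, G.degree i * y i ^ 2 + ∑ i, G.degree i * y i ^ 2 +
        2 * ∑ i, ∑ j, G.adjMatrix ℝ i j * (y i * y j) := by
    nth_rw 1 [← sum_adjMatrix_mul_left G fun i ↦ y i ^ 2]
    rw [← sum_adjMatrix_mul_right G fun i ↦ y i ^ 2]
    simp only [mul_sum, ← sum_add_distrib]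
    exact sum_congr rfl fun i _ ↦ sum_congr rfl fun j _ ↦ by ring
  linarith

end Cheeger

/-- For a `φ`-expander with minimum degree `d_min` and total degree `D`, and
`M = I − (1/2)L̃`, for all vertices `u, v` and `k ≥ 0`:
`(M^k)_{u,v} ≤ √(dᵤ dᵥ) (1/D + (1/d_min − 1/D) e^{−φ²k/4})`. -/
theorem lazy_walk_power_entry_bound (n : ℕ) (G : SimpleGraph (Fin n)) [DecidableRel G.Adj]
    (φ : ℝ) (hφ : 0 < φ) (hexp : IsExpander G φ)
    (dmin : ℕ) (hdmin : 1 ≤ dmin) (hmind : ∀ v, dmin ≤ G.degree v)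
    (nL M : Matrix (Fin n) (Fin n) ℝ)
    (hnL : nL = Matrix.of fun i j =>
      if i = j then 1
      else if G.Adj i j then -(1 / Real.sqrt ((G.degree i : ℝ) * (G.degree j : ℝ)))
      else 0)
    (hM : M = 1 - (1/2 : ℝ) • nL)
    (u v : Fin n) (k : ℕ) :
    (M ^ k) u v ≤ Real.sqrt ((G.degree u : ℝ) * (G.degree v : ℝ)) *
      (1 / (gvol G univ : ℝ) +
        (1 / (dmin : ℝ) - 1 / (gvol G univ : ℝ)) * Real.exp (-(φ^2) * k / 4)) := by
  have hd : ∀ i, (0 : ℝ) < G.degree i := fun i ↦ by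
    exact_mod_cast hdmin.trans (hmind i)
  set s : Fin n → ℝ := fun i ↦ √(G.degree i : ℝ) with hs
  have hspos : ∀ i, 0 < s i := fun i ↦ Real.sqrt_pos.2 (hd i)
  have hssq : ∀ i, s i ^ 2 = G.degree i := fun i ↦ Real.sq_sqrt (hd i).le
  have hss : s ⬝ᵥ s = gvol G univ := by simp [dotProduct, ← sq, hssq, gvol]
  have hMij : ∀ i j, M i j =
      1 / 2 * (if i = j then 1 else 0) + 1 / 2 * (G.adjMatrix ℝ i j * ((s i)⁻¹ * (s j)⁻¹)) := by
    intro i j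
    rw [hM, hnL]
    by_cases hij : i = j
    · subst hij; simp; norm_num
    · by_cases hadj : G.Adj i j <;>
        simp [hij, hadj, SimpleGraph.adjMatrix_apply, hs, mul_comm]
  have hsymm : M.IsSymm := by
    ext i j
    rw [transpose_apply, hMij, hMij, (G.isSymm_adjMatrix (α := ℝ)).apply, mul_comm (s i)⁻¹]
    simp only [eq_comm]
  have hfix : M *ᵥ s = s := by
    ext i
    have h1 : ∀ j, M i j * s j =
        1 / 2 * (if i = j then s j else 0) + 1 / 2 * (s i)⁻¹ * G.adjMatrix ℝ i j := fun j ↦ by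
      have := (hspos j).ne'
      rw [hMij]
      split_ifs <;> field_simp <;> ring
    simp only [mulVec, dotProduct, h1, sum_add_distrib, ← mul_sum, sum_adjMatrix_eq_degree,
      sum_ite_eq, mem_univ, if_true]
    rw [← hssq]
    have := (hspos i).ne'
    field_simp
    norm_num
  have hform : ∀ x : Fin n → ℝ, x ⬝ᵥ (M *ᵥ x) = 1 / 2 * (x ⬝ᵥ x) +
      1 / 2 * ∑ i, ∑ j, G.adjMatrix ℝ i j * ((x i / s i) * (x j / s j)) := by
    intro x
    simp only [mulVec, dotProduct, mul_sum, ← sum_add_distrib]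
    refine sum_congr rfl fun i _ ↦ ?_
    have h1 : ∀ j, x i * (M i j * x j) = (if i = j then 1 / 2 * (x i * x j) else 0) +
        1 / 2 * (G.adjMatrix ℝ i j * ((x i / s i) * (x j / s j))) := fun j ↦ by
      rw [hMij]
      split_ifs <;> ring
    simp only [h1, sum_add_distrib, sum_ite_eq, mem_univ, if_true]
  have hnorm : ∀ x : Fin n → ℝ, ∑ i, G.degree i * (x i / s i) ^ 2 = x ⬝ᵥ x := fun x ↦
    sum_congr rfl fun i _ ↦ by
      have := (hspos i).ne'
      rw [← hssq]; field_simp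
  have hpos : ∀ x, 0 ≤ x ⬝ᵥ (M *ᵥ x) := fun x ↦ by
    have := neg_sum_degree_le (G := G) fun i ↦ x i / s i
    rw [hnorm] at this
    rw [hform]; linarith
  have hle : ∀ x, x ⬝ᵥ s = 0 → x ⬝ᵥ (M *ᵥ x) ≤ Real.exp (-(φ ^ 2) / 4) * (x ⬝ᵥ x) := by
    intro x hx
    have hmean : ∑ i, G.degree i * (x i / s i) = 0 := by
      rw [← hx]
      exact sum_congr rfl fun i _ ↦ by
        have := (hspos i).ne'
        rw [← hssq]; field_simp
    have h1 := hexp.sq_mul_sum_le hφ.le hmean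
    rw [sum_adjMatrix_mul_sub_sq, hnorm] at h1
    have h2 := mul_le_mul_of_nonneg_right (Real.add_one_le_exp (-(φ ^ 2) / 4))
      (by simpa using dotProduct_star_self_nonneg x)
    rw [hform]; linarith
  have hDu : ∀ w, (G.degree w : ℝ) ≤ gvol G univ := fun w ↦ by
    exact_mod_cast single_le_sum (f := fun i ↦ G.degree i) (fun _ _ ↦ Nat.zero_le _) (mem_univ w)
  have hD : (0 : ℝ) < gvol G univ := (hd u).trans_le (hDu u)
  have hmain := pow_apply_le hsymm hfix (Real.exp_pos _) hpos hle (by rw [hss]; exact hD.ne') u v k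
  have hdm : (0 : ℝ) < dmin := by exact_mod_cast hdmin
  have hfac : ∀ w, √(1 - s w ^ 2 / gvol G univ) ≤ s w * √(1 / dmin - 1 / gvol G univ) := by
    intro w
    rw [hs, ← Real.sqrt_mul (hd w).le]
    refine Real.sqrt_le_sqrt ?_
    rw [Real.sq_sqrt (hd w).le, mul_sub, mul_one_div, mul_one_div]
    gcongr
    rw [one_le_div hdm]
    exact_mod_cast hmind w
  have hgap : (0 : ℝ) ≤ 1 / dmin - 1 / gvol G univ := by
    rw [sub_nonneg]
    exact one_div_le_one_div_of_le hdm ((by exact_mod_cast hmind u : (dmin : ℝ) ≤ _).trans (hDu u))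
  have hexpk : Real.exp (-(φ ^ 2) / 4) ^ k = Real.exp (-(φ ^ 2) * k / 4) := by
    rw [← Real.exp_nat_mul]; congr 1; ring
  rw [hss, hexpk] at hmain
  rw [Real.sqrt_mul (hd u).le]
  calc _ ≤ _ := hmain
    _ ≤ s u * s v / gvol G univ + Real.exp (-(φ ^ 2) * k / 4) *
        ((s u * √(1 / dmin - 1 / gvol G univ)) * (s v * √(1 / dmin - 1 / gvol G univ))) := by
        gcongr <;> exact hfac _
    _ = s u * s v * (1 / gvol G univ + √(1 / dmin - 1 / gvol G univ) ^ 2 *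
        Real.exp (-(φ ^ 2) * k / 4)) := by ring
    _ = _ := by rw [Real.sq_sqrt hgap]
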